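/- Let I be an open interval and f : I → ℝ continuous and strictly monotone. If the quasiarithmetic mean A_f (of all finite arities, or equivalently the two-variable one) is Jensen convex, then f is twice continuously differentiable on I with nowhere vanishing first derivative, and either f″ ≡ 0, or f″ is nowhere vanishing and the function f′/f″ is positive and concave on I. -/

import Mathlib

open Set Filter Topology

theorem aux_midpoint {E : Type*} [NormedAddCommGroup E] [NormedSpace ℝ E] {S : Set E}
    (hS : Convex ℝ S) {F : E → ℝ} (hF : ContinuousOn F S)
    (hm : ∀ x ∈ S, ∀ y ∈ S, F ((1/2:ℝ) • (x + y)) ≤ (F x + F y) / 2) : ConvexOn ℝ S F := by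
  refine ⟨hS, fun x hx y hy a b ha hb hab => ?_⟩
  have hmem : ∀ τ ∈ Icc (0:ℝ) 1, (1 - τ) • x + τ • y ∈ S := fun τ hτ =>
    hS hx hy (by linarith [hτ.2]) hτ.1 (by ring)
  set φ : ℝ → ℝ := fun τ => F ((1 - τ) • x + τ • y) - ((1 - τ) * F x + τ * F y) with hφ
  have hφc : ContinuousOn φ (Icc 0 1) := by
    apply ContinuousOn.sub
    · exact hF.comp (by fun_prop) hmem
    · fun_prop
  have hφm : ∀ s ∈ Icc (0:ℝ) 1, ∀ t ∈ Icc (0:ℝ) 1, φ ((s + t) / 2) ≤ (φ s + φ t) / 2 := by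
    intro s hs t ht
    have := hm _ (hmem s hs) _ (hmem t ht)
    have e : (1/2:ℝ) • (((1 - s) • x + s • y) + ((1 - t) • x + t • y))
      = (1 - (s + t) / 2) • x + ((s + t) / 2) • y := by
      module
    rw [e] at this
    simp only [hφ]
    linarith
  have h0 : φ 0 = 0 := by simp [hφ]
  have h1 : φ 1 = 0 := by simp [hφ]
  have key : φ b ≤ 0 := by
    by_contra hpos
    push Not at hpos
    have hbI : b ∈ Icc (0:ℝ) 1 := ⟨hb, by linarith⟩
    obtain ⟨M, hM, hMax⟩ := isCompact_Icc.exists_isMaxOn ⟨b, hbI⟩ hφc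
    have hT : IsCompact (Icc (0:ℝ) 1 ∩ φ ⁻¹' {φ M}) :=
      isCompact_Icc.of_isClosed_subset
        (hφc.preimage_isClosed_of_isClosed isClosed_Icc isClosed_singleton) inter_subset_left
    obtain ⟨t0, ⟨ht0, ht0M⟩, hleast⟩ := hT.exists_isLeast ⟨M, hM, rfl⟩
    have ht0M' : φ t0 = φ M := ht0M
    have hMb : φ b ≤ φ M := hMax hbI
    have hn0 : t0 ≠ 0 := by rintro rfl; linarith
    have hn1 : t0 ≠ 1 := by rintro rfl; linarith
    have hp0 : 0 < t0 := lt_of_le_of_ne ht0.1 hn0.symm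
    have hp1 : t0 < 1 := lt_of_le_of_ne ht0.2 hn1
    obtain ⟨δ, hδ, hδ1, hδ2⟩ : ∃ δ > 0, δ ≤ t0 ∧ δ ≤ 1 - t0 :=
      ⟨min t0 (1 - t0), lt_min hp0 (by linarith), min_le_left _ _, min_le_right _ _⟩
    have m1 : t0 - δ ∈ Icc (0:ℝ) 1 := ⟨by linarith, by linarith⟩
    have m2 : t0 + δ ∈ Icc (0:ℝ) 1 := ⟨by linarith, by linarith⟩
    have hh := hφm _ m1 _ m2
    rw [show (t0 - δ + (t0 + δ)) / 2 = t0 by ring] at hh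
    have l1 : φ (t0 - δ) ≤ φ M := hMax m1
    have l2 : φ (t0 + δ) ≤ φ M := hMax m2
    have l3 : φ (t0 - δ) = φ M := by linarith
    have := hleast ⟨m1, l3⟩
    linarith
  have ea : a = 1 - b := by linarith
  simp only [hφ] at key
  rw [ea]
  simp only [smul_eq_mul]
  linarith

theorem aux_deriv_cont {I : Set ℝ} (hI : IsOpen I) {f f' : ℝ → ℝ} (hf : ConvexOn ℝ I f)
    (hd : ∀ x ∈ I, HasDerivAt f (f' x) x) : ContinuousOn f' I := by
  intro x hx
  apply ContinuousAt.continuousWithinAt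
  have hIx : I ∈ 𝓝 x := hI.mem_nhds hx
  have hsl := (hasDerivAt_iff_tendsto_slope.1 (hd x hx))
  have hcs : ∀ z, z ≠ x → ContinuousAt (fun y => slope f y z) x := by
    intro z hz
    have hfx := (hd x hx).continuousAt
    simp only [slope_def_field]
    exact (continuousAt_const.sub hfx).div (continuousAt_const.sub continuousAt_id)
      (sub_ne_zero.2 hz)
  rw [ContinuousAt, tendsto_order]
  constructor
  · intro a ha
    have h1 : ∀ᶠ z in 𝓝[<] x, a < slope f x z ∧ z ∈ I ∧ z < x :=
      ((hsl.mono_left (nhdsWithin_mono x (fun z hz => ne_of_lt hz))).eventually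
        (lt_mem_nhds ha)).and
        ((eventually_of_mem (mem_nhdsWithin_of_mem_nhds hIx) fun _ h => h).and self_mem_nhdsWithin)
    obtain ⟨z, hz1, hz2, hz3⟩ := h1.exists
    have h2 : ∀ᶠ y in 𝓝 x, a < slope f y z :=
      (hcs z hz3.ne).eventually (lt_mem_nhds hz1)
    filter_upwards [h2, hIx, lt_mem_nhds hz3] with y hy1 hy2 hy3
    rw [slope_comm] at hy1
    exact hy1.trans_le (hf.slope_le_of_hasDerivAt hz2 hy2 hy3 (hd y hy2))
  · intro a ha
    have h1 : ∀ᶠ z in 𝓝[>] x, slope f x z < a ∧ z ∈ I ∧ x < z :=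
      ((hsl.mono_left (nhdsWithin_mono x (fun z hz => ne_of_gt hz))).eventually
        (gt_mem_nhds ha)).and
        ((eventually_of_mem (mem_nhdsWithin_of_mem_nhds hIx) fun _ h => h).and self_mem_nhdsWithin)
    obtain ⟨z, hz1, hz2, hz3⟩ := h1.exists
    have h2 : ∀ᶠ y in 𝓝 x, slope f y z < a :=
      (hcs z hz3.ne').eventually (gt_mem_nhds hz1)
    filter_upwards [h2, hIx, gt_mem_nhds hz3] with y hy1 hy2 hy3
    exact (hf.le_slope_of_hasDerivAt hy2 hz2 hy3 (hd y hy2)).trans_lt hy1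

theorem aux_second {φ φ' : ℝ → ℝ} {c : ℝ} (h0 : φ 0 = 0) (h0' : φ' 0 = 0)
    (hpos : ∀ᶠ e in 𝓝 0, 0 ≤ φ e) (hd : ∀ᶠ e in 𝓝 0, HasDerivAt φ (φ' e) e)
    (hd2 : HasDerivAt φ' c 0) : 0 ≤ c := by
  by_contra hc
  push Not at hc
  have hsl := (hasDerivAt_iff_tendsto_slope.1 hd2).mono_left
    (nhdsWithin_mono 0 (fun z (hz : 0 < z) => ne_of_gt hz))
  have h1 : ∀ᶠ e in 𝓝[>] (0:ℝ), φ' e < 0 := by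
    filter_upwards [hsl.eventually (gt_mem_nhds hc), self_mem_nhdsWithin] with e he (he0 : 0 < e)
    rw [slope_def_field, h0', sub_zero, sub_zero] at he
    by_contra hh
    push Not at hh
    have := div_nonneg hh he0.le
    linarith
  have h2 : ∀ᶠ e in 𝓝[>] (0:ℝ), φ' e < 0 ∧ 0 ≤ φ e ∧ HasDerivAt φ (φ' e) e :=
    h1.and ((hpos.filter_mono nhdsWithin_le_nhds).and (hd.filter_mono nhdsWithin_le_nhds))
  obtain ⟨u, hu, hu2⟩ := mem_nhdsGT_iff_exists_Ioo_subset.1 h2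
  have hu0 : (0:ℝ) < u := hu
  have hd0 : HasDerivAt φ (φ' 0) 0 := hd.self_of_nhds
  obtain ⟨ξ, hξ, he⟩ := exists_hasDerivAt_eq_slope φ φ' (show (0:ℝ) < u / 2 by linarith)
    (by
      intro y hy
      rcases eq_or_lt_of_le hy.1 with h | h
      · rw [← h]; exact hd0.continuousAt.continuousWithinAt
      · exact (hu2 ⟨h, by linarith [hy.2]⟩).2.2.continuousAt.continuousWithinAt)
    (fun y hy => (hu2 ⟨hy.1, by linarith [hy.2]⟩).2.2)
  have a1 := (hu2 (show ξ ∈ Ioo 0 u from ⟨hξ.1, by linarith [hξ.2]⟩)).1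
  have a2 := (hu2 (show u / 2 ∈ Ioo 0 u from ⟨by linarith, by linarith⟩)).2.1
  rw [he, h0] at a1
  have : 0 ≤ (φ (u / 2) - 0) / (u / 2 - 0) := div_nonneg (by linarith) (by linarith)
  linarith

theorem aux_concave {I : Set ℝ} (hI : Convex ℝ I) {f f' : ℝ → ℝ} (hc : ContinuousOn f I)
    (hd : ∀ x ∈ I, HasDerivWithinAt f (f' x) (Ioi x) x) (ha : AntitoneOn f' I) :
    ConcaveOn ℝ I f := by
  refine concaveOn_of_slope_anti_adjacent hI ?_
  intro x y z hx hz hxy hyz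
  have hoc := hI.ordConnected
  have hy : y ∈ I := hoc.out hx hz ⟨hxy.le, hyz.le⟩
  have s1 : Icc x y ⊆ I := hoc.out hx hy
  have s2 : Icc y z ⊆ I := hoc.out hy hz
  have B2 : f z ≤ f y + f' y * (z - y) := by
    refine image_le_of_deriv_right_le_deriv_boundary (f' := f') (hc.mono s2)
      (fun t ht => (hd t (s2 ⟨ht.1, ht.2.le⟩)).Ici_of_Ioi) (B := fun t => f y + f' y * (t - y))
      (B' := fun _ => f' y) (by simp) (by fun_prop) ?_ ?_ ⟨hyz.le, le_rfl⟩
    · intro t _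
      have := (((hasDerivAt_id t).sub_const y).const_mul (f' y)).const_add (f y)
      simpa using this.hasDerivWithinAt
    · intro t ht
      exact ha hy (s2 ⟨ht.1, ht.2.le⟩) ht.1
  have B1 : f x + f' y * (y - x) ≤ f y := by
    refine image_le_of_deriv_right_le_deriv_boundary (f := fun t => f x + f' y * (t - x))
      (f' := fun _ => f' y) (B := f) (B' := f') (by fun_prop) ?_ (by simp) (hc.mono s1)
      (fun t ht => (hd t (s1 ⟨ht.1, ht.2.le⟩)).Ici_of_Ioi) ?_ ⟨hxy.le, le_rfl⟩
    · intro t _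
      have := (((hasDerivAt_id t).sub_const x).const_mul (f' y)).const_add (f x)
      simpa using this.hasDerivWithinAt
    · intro t ht
      exact ha (s1 ⟨ht.1, ht.2.le⟩) hy ht.2.le
  have p1 : 0 < y - x := by linarith
  have p2 : 0 < z - y := by linarith
  calc (f z - f y) / (z - y) ≤ f' y := by rw [div_le_iff₀ p2]; linarith
    _ ≤ _ := by rw [le_div_iff₀ p1]; linarith

theorem aux_sides {I : Set ℝ} (hI : IsOpen I) {f : ℝ → ℝ} (hf : ConvexOn ℝ I f) {x : ℝ}
    (hx : x ∈ I) : ∃ l r, l ≤ r ∧ HasDerivWithinAt f l (Iio x) x ∧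
      HasDerivWithinAt f r (Ioi x) x := by
  have hx' : x ∈ interior I := by rwa [hI.interior_eq]
  exact ⟨_, _, hf.leftDeriv_le_rightDeriv_of_mem_interior hx',
    hf.hasDerivWithinAt_leftDeriv_of_mem_interior hx',
    hf.hasDerivWithinAt_rightDeriv_of_mem_interior hx'⟩

theorem aux_join {f : ℝ → ℝ} {l x : ℝ} (h1 : HasDerivWithinAt f l (Iio x) x)
    (h2 : HasDerivWithinAt f l (Ioi x) x) : HasDerivAt f l x := by
  have h := (h1.Iic_of_Iio).union (h2.Ici_of_Ioi)
  rw [Iic_union_Ici] at h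
  exact hasDerivWithinAt_univ.1 h

theorem aux_inv {I : Set ℝ} (hIop : IsOpen I) (hIcv : Convex ℝ I) {f : ℝ → ℝ}
    (hfc : ContinuousOn f I) (hfm : StrictMonoOn f I) :
    IsOpen (f '' I) ∧ Convex ℝ (f '' I) ∧ ∃ K : ℝ → ℝ, (∀ x ∈ I, K (f x) = x) ∧
      StrictMonoOn K (f '' I) ∧ ContinuousOn K (f '' I) := by
  have hop : IsOpen (f '' I) := by
    rw [isOpen_iff_mem_nhds]
    rintro _ ⟨x, hx, rfl⟩
    obtain ⟨l, u, ⟨hl, hu⟩, hs⟩ := mem_nhds_iff_exists_Ioo_subset.1 (hIop.mem_nhds hx)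
    obtain ⟨c, hc1, hc2⟩ := exists_between hl
    obtain ⟨d, hd1, hd2⟩ := exists_between hu
    have hc : c ∈ I := hs ⟨hc1, by linarith⟩
    have hd : d ∈ I := hs ⟨by linarith, hd2⟩
    have hsub : Icc c d ⊆ I := hIcv.ordConnected.out hc hd
    have := intermediate_value_Icc (by linarith) (hfc.mono hsub)
    exact mem_of_superset (Icc_mem_nhds (hfm hc hx hc2) (hfm hx hd hd1))
      (this.trans (image_mono hsub))
  have hcv : Convex ℝ (f '' I) := by
    have := hIcv.isPreconnected.image f hfc
    exact Real.convex_iff_isPreconnected.2 this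
  have hinj := hfm.injOn
  have hK : ∀ x ∈ I, Function.invFunOn f I (f x) = x := fun x hx =>
    hinj.leftInvOn_invFunOn hx
  have hKm : StrictMonoOn (Function.invFunOn f I) (f '' I) := by
    rintro _ ⟨x, hx, rfl⟩ _ ⟨y, hy, rfl⟩ h
    rw [hK x hx, hK y hy]
    exact (hfm.lt_iff_lt hx hy).1 h
  refine ⟨hop, hcv, Function.invFunOn f I, hK, hKm, ?_⟩
  rintro _ ⟨x, hx, rfl⟩
  apply ContinuousAt.continuousWithinAt
  refine continuousAt_of_monotoneOn_of_image_mem_nhds hKm.monotoneOn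
    (hop.mem_nhds ⟨x, hx, rfl⟩) ?_
  rw [hK x hx]
  refine mem_of_superset (hIop.mem_nhds hx) ?_
  intro y hy
  exact ⟨f y, ⟨y, hy, rfl⟩, hK y hy⟩

theorem aux_second_half {J : Set ℝ} (hJop : IsOpen J) (hJcv : Convex ℝ J) {K G : ℝ → ℝ}
    (hG : ∀ t ∈ J, 0 < G t) (hGc : ContinuousOn G J) (hGm : MonotoneOn G J)
    (hKm : StrictMonoOn K J)
    (hK : ∀ t ∈ J, HasDerivAt K (G t)⁻¹ t)
    (hD : ∀ s ∈ J, ∀ t ∈ J, ∀ s' ∈ J, ∀ t' ∈ J,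
      G s * (K s' - K s) + G t * (K t' - K t) ≤
        2 * (G ((s + t) / 2) * (K ((s' + t') / 2) - K ((s + t) / 2)))) :
    ∃ G' : ℝ → ℝ, (∀ t ∈ J, HasDerivAt G (G' t) t) ∧ ContinuousOn G' J ∧
      ((∀ t ∈ J, G' t = 0) ∨ ((∀ t ∈ J, 0 < G' t) ∧ ConcaveOn ℝ J (fun t => G t / G' t))) := by
  have hKc : ContinuousOn K J := fun t ht => (hK t ht).continuousAt.continuousWithinAt
  have hmid : ∀ s ∈ J, ∀ t ∈ J, (s + t) / 2 ∈ J := by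
    intro s hs t ht
    have := hJcv hs ht (show (0:ℝ) ≤ 1/2 by norm_num) (show (0:ℝ) ≤ 1/2 by norm_num) (by norm_num)
    simp only [smul_eq_mul] at this
    rwa [show 1/2 * s + 1/2 * t = (s + t)/2 by ring] at this
  have hconv : ∀ p ∈ J, ConvexOn ℝ J (fun s => - (G s * (K p - K s))) := by
    intro p hp
    apply aux_midpoint hJcv
    · exact (hGc.mul (continuousOn_const.sub hKc)).neg
    · intro s hs t ht
      have := hD s hs t ht p hp p hp
      rw [show (p + p) / 2 = p by ring] at this
      rw [smul_eq_mul, show 1/2 * (s + t) = (s + t) / 2 by ring]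
      linarith
  have hexG : ∀ s ∈ J, ∃ c, HasDerivAt G c s := by
    intro s hs
    obtain ⟨l, u, ⟨hl, hu⟩, hsub⟩ := mem_nhds_iff_exists_Ioo_subset.1 (hJop.mem_nhds hs)
    obtain ⟨c, hc1, hc2⟩ := exists_between hl
    obtain ⟨d, hd1, hd2⟩ := exists_between hu
    have hc : c ∈ J := hsub ⟨hc1, by linarith⟩
    have hd : d ∈ J := hsub ⟨by linarith, hd2⟩
    have hKs : ∀ S : Set ℝ, HasDerivWithinAt K (G s)⁻¹ S s := fun S => (hK s hs).hasDerivWithinAt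
    have hside : ∀ p ∈ J, p ≠ s → ∃ a b, a * (K p - K s) ≥ b * (K p - K s) ∧
        HasDerivWithinAt G a (Iio s) s ∧ HasDerivWithinAt G b (Ioi s) s := by
      intro p hp hps
      have hne : K p - K s ≠ 0 := sub_ne_zero.2 (fun h => hps (hKm.injOn hp hs h))
      obtain ⟨l, r, hlr, h1, h2⟩ := aux_sides hJop (hconv p hp) hs
      have hGe : ∀ᶠ t in 𝓝 s, G t = (-(- (G t * (K p - K t)))) / (K p - K t) := by
        have : ∀ᶠ t in 𝓝 s, K p - K t ≠ 0 :=
          (continuousAt_const.sub (hK s hs).continuousAt).eventually_ne hne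
        filter_upwards [this] with t ht
        field_simp
      have gen : ∀ (S : Set ℝ) (l : ℝ), HasDerivWithinAt (fun s => - (G s * (K p - K s))) l S s →
          HasDerivWithinAt G ((-l + 1) / (K p - K s)) S s := by
        intro S l h
        have hq := (h.neg.div ((hKs S).const_sub (K p)) hne).congr_of_eventuallyEq
          (hGe.filter_mono nhdsWithin_le_nhds) hGe.self_of_nhds
        refine hq.congr_deriv ?_
        have := (hG s hs).ne'
        simp only [Pi.neg_apply]
        field_simp
        ring
      refine ⟨_, _, ?_, gen _ _ h1, gen _ _ h2⟩
      rw [div_mul_cancel₀ _ hne, div_mul_cancel₀ _ hne]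
      linarith
    obtain ⟨a, b, hab, ha, hb⟩ := hside d hd hd1.ne'
    obtain ⟨a', b', hab', ha', hb'⟩ := hside c hc hc2.ne
    have ea : a = a' := (uniqueDiffWithinAt_Iio s).eq_deriv _ ha ha'
    have eb : b = b' := (uniqueDiffWithinAt_Ioi s).eq_deriv _ hb hb'
    subst ea eb
    have k1 : 0 < K d - K s := sub_pos.2 (hKm hs hd hd1)
    have k2 : K c - K s < 0 := sub_neg.2 (hKm hc hs hc2)
    have e1 : b ≤ a := le_of_mul_le_mul_right hab k1
    have e2 : a ≤ b := by nlinarith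
    have e : a = b := le_antisymm e2 e1
    subst e
    exact ⟨a, aux_join ha hb⟩
  choose! G' hG' using hexG
  refine ⟨G', hG', ?_⟩
  have hG'c : ContinuousOn G' J := by
    intro s hs
    apply ContinuousAt.continuousWithinAt
    obtain ⟨l, u, ⟨hl, hu⟩, hsub⟩ := mem_nhds_iff_exists_Ioo_subset.1 (hJop.mem_nhds hs)
    obtain ⟨d, hd1, hd2⟩ := exists_between hu
    have hd : d ∈ J := hsub ⟨by linarith, hd2⟩
    have h1 : ContinuousOn (fun t => -(G' t * (K d - K t) + G t * (-(G t)⁻¹))) J :=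
      aux_deriv_cont hJop (hconv d hd) (fun t ht =>
        ((hG' t ht).mul ((hK t ht).const_sub (K d))).neg)
    have k1 : 0 < K d - K s := sub_pos.2 (hKm hs hd hd1)
    have hKs := (hK s hs).continuousAt
    have h2 : ContinuousAt (fun t => (-(-(G' t * (K d - K t) + G t * (-(G t)⁻¹))) + 1)
        / (K d - K t)) s :=
      (((h1.continuousAt (hJop.mem_nhds hs)).neg).add continuousAt_const).div
        (continuousAt_const.sub hKs) k1.ne'
    refine h2.congr ?_
    have : ∀ᶠ t in 𝓝 s, K d - K t ≠ 0 :=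
      (continuousAt_const.sub hKs).eventually_ne k1.ne'
    filter_upwards [this, hJop.mem_nhds hs] with t ht htJ
    have := (hG t htJ).ne'
    field_simp
    ring
  refine ⟨hG'c, ?_⟩
  have hG'0 : ∀ t ∈ J, 0 ≤ G' t := by
    intro t ht
    have h1 := (hG' t ht).hasDerivWithinAt (s := J)
    have h2 := hGm.derivWithin_nonneg (x := t)
    rwa [h1.derivWithin (hJop.uniqueDiffWithinAt ht)] at h2
  have hP : ∀ s ∈ J, ∀ t ∈ J, ∀ a b : ℝ,
      (a + b) ^ 2 / 2 * (G' ((s + t) / 2) / G ((s + t) / 2)) ≤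
        a ^ 2 * (G' s / G s) + b ^ 2 * (G' t / G t) := by
    intro s hs t ht a b
    have hm := hmid s hs t ht
    set m := (s + t) / 2 with hmdef
    have line : ∀ p ∈ J, ∀ q : ℝ, ∀ᶠ e in 𝓝 (0:ℝ), p + e * q ∈ J := by
      intro p hp q
      have : ContinuousAt (fun e : ℝ => p + e * q) 0 := by fun_prop
      exact this.eventually_mem (hJop.mem_nhds (by simpa using hp))
    have dline : ∀ p q e : ℝ, HasDerivAt (fun e : ℝ => p + e * q) q e := by
      intro p q e
      simpa using ((hasDerivAt_id e).mul_const q).const_add p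
    have dK : ∀ p q e : ℝ, p + e * q ∈ J →
        HasDerivAt (fun e => G p * (K (p + e * q) - K p)) (G p * ((G (p + e * q))⁻¹ * q)) e := by
      intro p q e h
      exact (((hK _ h).comp e (dline p q e)).sub_const _).const_mul _
    have dG : ∀ p ∈ J, ∀ q : ℝ,
        HasDerivAt (fun e => G p * ((G (p + e * q))⁻¹ * q)) (- (q ^ 2 * (G' p / G p))) 0 := by
      intro p hp q
      have h0 : p + 0 * q = p := by ring
      have h1 : HasDerivAt (fun e => G (p + e * q)) (G' p * q) 0 :=
        HasDerivAt.comp (h₂ := G) (0:ℝ) (by rw [h0]; exact hG' p hp) (dline p q 0)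
      have h2 := ((h1.inv (by rw [h0]; exact (hG p hp).ne')).mul_const q).const_mul (G p)
      refine h2.congr_deriv ?_
      have := (hG p hp).ne'
      rw [h0]
      field_simp
    set c := (a + b) / 2 with hc
    have := aux_second
      (φ := fun e => 2 * (G m * (K (m + e * c) - K m)) - (G s * (K (s + e * a) - K s))
        - (G t * (K (t + e * b) - K t)))
      (φ' := fun e => 2 * (G m * ((G (m + e * c))⁻¹ * c)) - (G s * ((G (s + e * a))⁻¹ * a))
        - (G t * ((G (t + e * b))⁻¹ * b)))
      (c := 2 * (- (c ^ 2 * (G' m / G m))) - (- (a ^ 2 * (G' s / G s)))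
        - (- (b ^ 2 * (G' t / G t))))
      (by simp)
      (by
        have h1 := (hG s hs).ne'
        have h2 := (hG t ht).ne'
        have h3 := (hG m hm).ne'
        simp only [zero_mul, add_zero]
        field_simp
        rw [hc]; ring)
      (by
        filter_upwards [line s hs a, line t ht b] with e h1 h2
        have := hD s hs t ht _ h1 _ h2
        rw [show (s + e * a + (t + e * b)) / 2 = m + e * c by rw [hmdef, hc]; ring, ← hmdef] at this
        linarith)
      (by
        filter_upwards [line s hs a, line t ht b, line m hm c] with e h1 h2 h3
        exact (((dK _ _ _ h3).const_mul 2).sub (dK _ _ _ h1)).sub (dK _ _ _ h2))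
      ((((dG _ hm _).const_mul 2).sub (dG _ hs _)).sub (dG _ ht _))
    have e : 2 * c ^ 2 = (a + b) ^ 2 / 2 := by rw [hc]; ring
    rw [← e]
    linarith
  by_cases hz : ∃ s ∈ J, G' s = 0
  · left
    obtain ⟨s0, hs0, hs0z⟩ := hz
    have hprop : ∀ s ∈ J, G' s = 0 → ∀ t ∈ J, G' ((s + t) / 2) = 0 := by
      intro s hs hsz t ht
      have hm := hmid s hs t ht
      have := hP s hs t ht 1 0
      rw [hsz] at this
      have h1 : G' ((s + t) / 2) / G ((s + t) / 2) ≤ 0 := by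
        norm_num at this
        linarith
      have h2 := (div_le_iff₀ (hG _ hm)).1 h1
      exact le_antisymm (by linarith) (hG'0 _ hm)
    have hpc : IsPreconnected J := hJcv.isPreconnected
    have hsub : J ⊆ {t | t ∈ J ∧ G' t = 0} := by
      have hopen : IsOpen {t | t ∈ J ∧ G' t = 0} := by
        rw [isOpen_iff_mem_nhds]
        rintro s ⟨hs, hsz⟩
        have : ContinuousAt (fun t : ℝ => 2 * t - s) s := by fun_prop
        have h1 : ∀ᶠ t in 𝓝 s, 2 * t - s ∈ J :=
          this.eventually_mem (hJop.mem_nhds (by ring_nf; exact hs))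
        filter_upwards [h1, hJop.mem_nhds hs] with t ht htJ
        refine ⟨htJ, ?_⟩
        have := hprop s hs hsz _ ht
        rwa [show (s + (2 * t - s)) / 2 = t by ring] at this
      have hopen2 : IsOpen {t | t ∈ J ∧ G' t ≠ 0} :=
        hG'c.isOpen_inter_preimage hJop (isOpen_ne (x := (0:ℝ)))
      refine hpc.subset_left_of_subset_union hopen hopen2 ?_ ?_ ⟨s0, hs0, hs0, hs0z⟩
      · rw [Set.disjoint_left]
        rintro t ⟨_, h1⟩ ⟨_, h2⟩
        exact h2 h1
      · intro t ht
        by_cases h : G' t = 0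
        · exact Or.inl ⟨ht, h⟩
        · exact Or.inr ⟨ht, h⟩
    exact fun t ht => (hsub ht).2
  · right
    push Not at hz
    have hpos : ∀ t ∈ J, 0 < G' t := fun t ht => lt_of_le_of_ne (hG'0 t ht) (hz t ht).symm
    refine ⟨hpos, ?_⟩
    have hcv : ConvexOn ℝ J (-(fun t => G t / G' t)) := by
      apply aux_midpoint hJcv
      · exact (hGc.div hG'c hz).neg
      · intro s hs t ht
        rw [smul_eq_mul, show 1/2 * (s + t) = (s + t) / 2 by ring]
        have hm := hmid s hs t ht
        have h := hP s hs t ht (G s / G' s) (G t / G' t)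
        simp only [Pi.neg_apply]
        generalize (s + t) / 2 = m at *
        have p1 := hpos s hs
        have p2 := hpos t ht
        have p3 := hpos m hm
        have q1 := hG s hs
        have q2 := hG t ht
        have q3 := hG m hm
        have e1 : (G s / G' s) ^ 2 * (G' s / G s) = G s / G' s := by field_simp
        have e2 : (G t / G' t) ^ 2 * (G' t / G t) = G t / G' t := by field_simp
        rw [e1, e2] at h
        have e3 : G' m / G m = (G m / G' m)⁻¹ := by rw [inv_div]
        rw [e3] at h
        have w1 : 0 < G s / G' s := by positivity
        have w2 : 0 < G t / G' t := by positivity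
        have w3 : 0 < G m / G' m := by positivity
        generalize G s / G' s = x at *
        generalize G t / G' t = y at *
        generalize G m / G' m = z at *
        rw [← div_eq_mul_inv, div_le_iff₀ w3] at h
        have : (x + y) * ((x + y) / 2) ≤ (x + y) * z := by linarith
        have := le_of_mul_le_mul_left this (by linarith)
        linarith
    exact neg_convexOn_iff.1 hcv

theorem aux_mid {J : Set ℝ} (hJcv : Convex ℝ J) : ∀ s ∈ J, ∀ t ∈ J, (s + t) / 2 ∈ J := by
  intro s hs t ht
  have := hJcv hs ht (show (0:ℝ) ≤ 1/2 by norm_num) (show (0:ℝ) ≤ 1/2 by norm_num) (by norm_num)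
  simp only [smul_eq_mul] at this
  rwa [show 1/2 * s + 1/2 * t = (s + t)/2 by ring] at this

theorem aux_first_half {I : Set ℝ} (hIop : IsOpen I) (hIcv : Convex ℝ I) {f K : ℝ → ℝ}
    (hfc : ContinuousOn f I) (hfm : StrictMonoOn f I)
    (hJop : IsOpen (f '' I)) (hJcv : Convex ℝ (f '' I))
    (hKf : ∀ x ∈ I, K (f x) = x) (hKm : StrictMonoOn K (f '' I)) (hKc : ContinuousOn K (f '' I))
    (hB : ∀ x ∈ I, ∀ y ∈ I, ∀ u ∈ I, ∀ v ∈ I,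
      K ((f ((x + y) / 2) + f ((u + v) / 2)) / 2) ≤
        (K ((f x + f u) / 2) + K ((f y + f v) / 2)) / 2) :
    ConvexOn ℝ I f ∧ ∃ g : ℝ → ℝ, ∀ x ∈ I, 0 < g x ∧ HasDerivAt f (g x) x := by
  have hJm : ∀ x ∈ I, f x ∈ f '' I := fun x hx => ⟨x, hx, rfl⟩
  have hfK : ∀ t ∈ f '' I, f (K t) = t := by
    rintro _ ⟨x, hx, rfl⟩; rw [hKf x hx]
  have hKI : ∀ t ∈ f '' I, K t ∈ I := by
    rintro _ ⟨x, hx, rfl⟩; rwa [hKf x hx]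
  have hmJ := aux_mid hJcv
  have hmI := aux_mid hIcv
  have hconv : ConvexOn ℝ I f := by
    apply aux_midpoint hIcv hfc
    intro x hx y hy
    rw [smul_eq_mul, show 1/2 * (x + y) = (x + y) / 2 by ring]
    have h := hB x hx y hy y hy x hx
    have hm := hmI x hx y hy
    have hJ2 := hmJ _ (hJm x hx) _ (hJm y hy)
    rw [show (y + x) / 2 = (x + y) / 2 by ring, show f y + f x = f x + f y by ring,
      show (f ((x+y)/2) + f ((x+y)/2)) / 2 = f ((x+y)/2) by ring, hKf _ hm] at h
    have h2 : (x + y) / 2 ≤ K ((f x + f y) / 2) := by linarith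
    have := hfm.monotoneOn hm (hKI _ hJ2) h2
    rwa [hfK _ hJ2] at this
  refine ⟨hconv, ?_⟩
  have hleft : ∀ x ∈ I, ∃ z ∈ I, z < x := by
    intro x hx
    obtain ⟨l, u, ⟨hl, hu⟩, hs⟩ := mem_nhds_iff_exists_Ioo_subset.1 (hIop.mem_nhds hx)
    obtain ⟨c, hc1, hc2⟩ := exists_between hl
    exact ⟨c, hs ⟨hc1, by linarith⟩, hc2⟩
  have hlpos : ∀ x ∈ I, ∀ c, HasDerivWithinAt f c (Iio x) x → 0 < c := by
    intro x hx c hc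
    obtain ⟨z, hz, hzx⟩ := hleft x hx
    have := hconv.slope_le_of_hasDerivWithinAt_Iio hz hx hzx hc
    refine lt_of_lt_of_le ?_ this
    rw [slope_def_field]
    exact div_pos (sub_pos.2 (hfm hz hx hzx)) (sub_pos.2 hzx)
  have hex : ∀ m ∈ I, ∃ c, 0 < c ∧ HasDerivAt f c m := by
    intro m hm
    have hfm_c : ContinuousAt f m := hfc.continuousAt (hIop.mem_nhds hm)
    have hnb : ∀ᶠ x in 𝓝 m, x ∈ I ∧ 2 * f m - f x ∈ f '' I := by
      have h1 : ContinuousAt (fun x => 2 * f m - f x) m := continuousAt_const.sub hfm_c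
      exact (hIop.eventually_mem hm).and (h1.eventually_mem (hJop.mem_nhds
        (by rw [show 2 * f m - f m = f m by ring]; exact hJm m hm)))
    have hae := MeasureTheory.Measure.dense_of_ae hfm.monotoneOn.ae_differentiableWithinAt_of_mem
    obtain ⟨x, hxd, hx, hyJ⟩ := hae.inter_nhds_nonempty hnb
    have hxd' : DifferentiableAt ℝ f x := (hxd hx).differentiableAt (hIop.mem_nhds hx)
    obtain ⟨y, hy, hfy⟩ := hyJ
    have hc := hxd'.hasDerivAt
    set c := deriv f x
    have hcpos : 0 < c := hlpos x hx c hc.hasDerivWithinAt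
    set φ : ℝ → ℝ := fun z => K ((f z + f y) / 2) with hφ
    have hφx : φ x = m := by
      simp only [hφ]
      rw [hfy, show (f x + (2 * f m - f x)) / 2 = f m by ring, hKf m hm]
    have hJz : ∀ z ∈ I, (f z + f y) / 2 ∈ f '' I := fun z hz => hmJ _ (hJm z hz) _ (hJm y hy)
    have hφconv : ConvexOn ℝ I φ := by
      apply aux_midpoint hIcv
      · exact hKc.comp ((hfc.add continuousOn_const).div_const 2) hJz
      · intro z hz w hw
        rw [smul_eq_mul, show 1/2 * (z + w) = (z + w) / 2 by ring]
        have := hB z hz w hw y hy y hy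
        rwa [show (y + y) / 2 = y by ring] at this
    have hφmono : StrictMonoOn φ I := fun z hz w hw hzw =>
      hKm (hJz z hz) (hJz w hw) (by have := hfm hz hw hzw; linarith)
    obtain ⟨l, r, hlr, hl, hr⟩ := aux_sides hIop hφconv hx
    obtain ⟨l', r', hlr', hl', hr'⟩ := aux_sides hIop hconv hm
    have hfφ : ∀ z ∈ I, f (φ z) = (f z + f y) / 2 := fun z hz => hfK _ (hJz z hz)
    have hcomp : ∀ S : Set ℝ, HasDerivWithinAt (fun z => (f z + f y) / 2) (c / 2) S x := fun S =>
      ((hc.add_const _).div_const 2).hasDerivWithinAt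
    have e1 : l' * l = c / 2 := by
      have u : UniqueDiffWithinAt ℝ (Iio x ∩ I) x :=
        (uniqueDiffWithinAt_Iio x).inter (hIop.mem_nhds hx)
      have h1 : HasDerivWithinAt (f ∘ φ) (l' * l) (Iio x ∩ I) x := by
        refine HasDerivWithinAt.comp (s' := Iio m) x (by rw [hφx]; exact hl') (hl.mono inter_subset_left) ?_
        rintro z ⟨hz1, hz2⟩
        have := hφmono hz2 hx hz1
        rwa [hφx] at this
      have h2 : HasDerivWithinAt (f ∘ φ) (c / 2) (Iio x ∩ I) x :=
        (hcomp _).congr (fun z hz => hfφ z hz.2) (hfφ x hx)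
      exact u.eq_deriv _ h1 h2
    have e2 : r' * r = c / 2 := by
      have u : UniqueDiffWithinAt ℝ (Ioi x ∩ I) x :=
        (uniqueDiffWithinAt_Ioi x).inter (hIop.mem_nhds hx)
      have h1 : HasDerivWithinAt (f ∘ φ) (r' * r) (Ioi x ∩ I) x := by
        refine HasDerivWithinAt.comp (s' := Ioi m) x (by rw [hφx]; exact hr') (hr.mono inter_subset_left) ?_
        rintro z ⟨hz1, hz2⟩
        have := hφmono hx hz2 hz1
        rwa [hφx] at this
      have h2 : HasDerivWithinAt (f ∘ φ) (c / 2) (Ioi x ∩ I) x :=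
        (hcomp _).congr (fun z hz => hfφ z hz.2) (hfφ x hx)
      exact u.eq_deriv _ h1 h2
    have l'pos : 0 < l' := hlpos m hm l' hl'
    have lpos : 0 < l := by
      by_contra h
      push Not at h
      nlinarith
    have heq : l' = r' := by
      refine le_antisymm hlr' ?_
      by_contra h
      push Not at h
      nlinarith
    rw [← heq] at hr'
    exact ⟨l', l'pos, aux_join hl' hr'⟩
  choose! g hg using hex
  exact ⟨g, hg⟩

theorem aux_grad {I : Set ℝ} (hIop : IsOpen I) (hIcv : Convex ℝ I) {f K g : ℝ → ℝ}
    (hfc : ContinuousOn f I)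
    (hJcv : Convex ℝ (f '' I)) (hKc : ContinuousOn K (f '' I))
    (hB : ∀ x ∈ I, ∀ y ∈ I, ∀ u ∈ I, ∀ v ∈ I,
      K ((f ((x + y) / 2) + f ((u + v) / 2)) / 2) ≤
        (K ((f x + f u) / 2) + K ((f y + f v) / 2)) / 2)
    (hg : ∀ x ∈ I, 0 < g x ∧ HasDerivAt f (g x) x)
    (hKI : ∀ t ∈ f '' I, K t ∈ I)
    (hK : ∀ t ∈ f '' I, HasDerivAt K (g (K t))⁻¹ t) :
    ∀ x ∈ I, ∀ y ∈ I, ∀ u ∈ I, ∀ v ∈ I,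
      g x * (u - x) + g y * (v - y) ≤
        2 * (g (K ((f x + f y) / 2)) * (K ((f u + f v) / 2) - K ((f x + f y) / 2))) := by
  intro x hx y hy u hu v hv
  have hJm : ∀ x ∈ I, f x ∈ f '' I := fun x hx => ⟨x, hx, rfl⟩
  have hmJ := aux_mid hJcv
  have line : ∀ x ∈ I, ∀ u ∈ I, ∀ τ ∈ Icc (0:ℝ) 1, x + τ * (u - x) ∈ I := by
    intro x hx u hu τ hτ
    have := hIcv hx hu (show 0 ≤ 1 - τ by linarith [hτ.2]) hτ.1 (by ring)
    simp only [smul_eq_mul] at this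
    rwa [show (1 - τ) * x + τ * u = x + τ * (u - x) by ring] at this
  set ψ : ℝ → ℝ := fun τ => K ((f (x + τ * (u - x)) + f (y + τ * (v - y))) / 2) with hψ
  have hJ0 := hmJ _ (hJm x hx) _ (hJm y hy)
  have hψconv : ConvexOn ℝ (Icc 0 1) ψ := by
    apply aux_midpoint (convex_Icc 0 1)
    · refine hKc.comp (((hfc.comp (by fun_prop) (line x hx u hu)).add
        (hfc.comp (by fun_prop) (line y hy v hv))).div_const 2) ?_
      intro τ hτ
      exact hmJ _ (hJm _ (line x hx u hu τ hτ)) _ (hJm _ (line y hy v hv τ hτ))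
    · intro s hs t ht
      have := hB _ (line x hx u hu s hs) _ (line x hx u hu t ht) _ (line y hy v hv s hs)
        _ (line y hy v hv t ht)
      simp only [hψ, smul_eq_mul]
      rw [show x + 1/2 * (s + t) * (u - x) = (x + s * (u - x) + (x + t * (u - x))) / 2 by ring,
        show y + 1/2 * (s + t) * (v - y) = (y + s * (v - y) + (y + t * (v - y))) / 2 by ring]
      exact this
  have dline : ∀ x ∈ I, ∀ u : ℝ, HasDerivAt (fun τ : ℝ => f (x + τ * (u - x))) (g x * (u - x)) 0 := by
    intro x hx u
    have h1 : HasDerivAt (fun τ : ℝ => x + τ * (u - x)) (u - x) 0 := by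
      simpa using ((hasDerivAt_id (0:ℝ)).mul_const (u - x)).const_add x
    exact HasDerivAt.comp (h₂ := f) (0:ℝ) (by simpa using (hg x hx).2) h1
  have hψd : HasDerivAt ψ ((g (K ((f x + f y) / 2)))⁻¹ * ((g x * (u - x) + g y * (v - y)) / 2)) 0 := by
    refine HasDerivAt.comp (h₂ := K) (0:ℝ) ?_ (((dline x hx u).add (dline y hy v)).div_const 2)
    simpa using hK _ hJ0
  have h := hψconv.le_slope_of_hasDerivAt (by simp) (by simp) (zero_lt_one) hψd
  have e0 : ψ 0 = K ((f x + f y) / 2) := by simp [hψ]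
  have e1 : ψ 1 = K ((f u + f v) / 2) := by simp [hψ]
  rw [slope_def_field, e0, e1, sub_zero, div_one, inv_mul_le_iff₀ (hg _ (hKI _ hJ0)).1] at h
  linarith

theorem aux_main {I : Set ℝ} (hIop : IsOpen I) (hIcv : Convex ℝ I)
    {f : ℝ → ℝ} (hfc : ContinuousOn f I)
    (hfm : StrictMonoOn f I)
    {A : ℝ → ℝ → ℝ}
    (hA : ∀ x ∈ I, ∀ y ∈ I, A x y ∈ I ∧ f (A x y) = (f x + f y) / 2)
    (hconv : ∀ x ∈ I, ∀ y ∈ I, ∀ u ∈ I, ∀ v ∈ I,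
      A ((x + y) / 2) ((u + v) / 2) ≤ (A x u + A y v) / 2) :
    ContDiffOn ℝ 2 f I ∧ (∀ x ∈ I, deriv f x ≠ 0) ∧
    ((∀ x ∈ I, deriv (deriv f) x = 0) ∨
      ((∀ x ∈ I, deriv (deriv f) x ≠ 0) ∧
        (∀ x ∈ I, 0 < deriv f x / deriv (deriv f) x) ∧
        ConcaveOn ℝ I (fun x => deriv f x / deriv (deriv f) x))) := by
  obtain ⟨hJop, hJcv, K, hKf, hKm, hKc⟩ := aux_inv hIop hIcv hfc hfm
  have hmI := aux_mid hIcv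
  have hmJ := aux_mid hJcv
  have hJm : ∀ x ∈ I, f x ∈ f '' I := fun x hx => ⟨x, hx, rfl⟩
  have hfK : ∀ t ∈ f '' I, f (K t) = t := by
    rintro _ ⟨x, hx, rfl⟩; rw [hKf x hx]
  have hKI : ∀ t ∈ f '' I, K t ∈ I := by
    rintro _ ⟨x, hx, rfl⟩; rwa [hKf x hx]
  have hAK : ∀ x ∈ I, ∀ y ∈ I, A x y = K ((f x + f y) / 2) := by
    intro x hx y hy
    rw [← (hA x hx y hy).2, hKf _ (hA x hx y hy).1]
  have hB : ∀ x ∈ I, ∀ y ∈ I, ∀ u ∈ I, ∀ v ∈ I,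
      K ((f ((x + y) / 2) + f ((u + v) / 2)) / 2) ≤
        (K ((f x + f u) / 2) + K ((f y + f v) / 2)) / 2 := by
    intro x hx y hy u hu v hv
    rw [← hAK _ (hmI x hx y hy) _ (hmI u hu v hv), ← hAK x hx u hu, ← hAK y hy v hv]
    exact hconv x hx y hy u hu v hv
  obtain ⟨hfconv, g, hg⟩ := aux_first_half hIop hIcv hfc hfm hJop hJcv hKf hKm hKc hB
  have hgc : ContinuousOn g I := aux_deriv_cont hIop hfconv (fun x hx => (hg x hx).2)
  have hgm : MonotoneOn g I := by
    intro x hx y hy hxy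
    have := hfconv.monotoneOn_deriv (fun x hx => (hg x hx).2.differentiableAt) hx hy hxy
    rwa [(hg x hx).2.deriv, (hg y hy).2.deriv] at this
  have hK : ∀ t ∈ f '' I, HasDerivAt K (g (K t))⁻¹ t := by
    intro t ht
    refine HasDerivAt.of_local_left_inverse (hKc.continuousAt (hJop.mem_nhds ht))
      (hg _ (hKI t ht)).2 (hg _ (hKI t ht)).1.ne' ?_
    filter_upwards [hJop.mem_nhds ht] with s hs using hfK s hs
  have hgrad := aux_grad hIop hIcv hfc hJcv hKc hB hg hKI hK
  obtain ⟨G', hG', hG'c, halt⟩ := aux_second_half hJop hJcv (K := K) (G := fun t => g (K t))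
    (fun t ht => (hg _ (hKI t ht)).1) (hgc.comp hKc hKI)
    (fun s hs t ht hst => hgm (hKI s hs) (hKI t ht) (hKm.monotoneOn hs ht hst)) hKm hK
    (by
      intro s hs t ht s' hs' t' ht'
      have := hgrad _ (hKI s hs) _ (hKI t ht) _ (hKI s' hs') _ (hKI t' ht')
      rwa [hfK s hs, hfK t ht, hfK s' hs', hfK t' ht'] at this)
  have hder : ∀ x ∈ I, deriv f x = g x := fun x hx => (hg x hx).2.deriv
  have hg' : ∀ x ∈ I, HasDerivAt g (G' (f x) * g x) x := by
    intro x hx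
    have h1 := (hG' _ (hJm x hx)).comp x (hg x hx).2
    refine h1.congr_of_eventuallyEq ?_
    filter_upwards [hIop.mem_nhds hx] with z hz
    simp only [Function.comp_apply]
    rw [hKf z hz]
  have hdg' : ∀ x ∈ I, HasDerivAt (deriv f) (G' (f x) * g x) x := by
    intro x hx
    refine (hg' x hx).congr_of_eventuallyEq ?_
    filter_upwards [hIop.mem_nhds hx] with z hz using hder z hz
  have hdd : ∀ x ∈ I, deriv (deriv f) x = G' (f x) * g x := fun x hx => (hdg' x hx).deriv
  have hG'f : ContinuousOn (fun x => G' (f x)) I := hG'c.comp hfc hJm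
  refine ⟨?_, fun x hx => by rw [hder x hx]; exact (hg x hx).1.ne', ?_⟩
  · rw [show (2 : WithTop ℕ∞) = 1 + 1 by norm_num, contDiffOn_succ_iff_deriv_of_isOpen hIop]
    refine ⟨fun x hx => (hg x hx).2.differentiableAt.differentiableWithinAt, by simp, ?_⟩
    rw [show (1 : WithTop ℕ∞) = 0 + 1 by norm_num, contDiffOn_succ_iff_deriv_of_isOpen hIop]
    refine ⟨fun x hx => (hdg' x hx).differentiableAt.differentiableWithinAt, by simp, ?_⟩
    rw [contDiffOn_zero]
    exact (hG'f.mul hgc).congr hdd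
  · rcases halt with h0 | ⟨hpos, hcc⟩
    · left
      intro x hx
      rw [hdd x hx, h0 _ (hJm x hx), zero_mul]
    · right
      have hρ : ∀ x ∈ I, deriv f x / deriv (deriv f) x = (G' (f x))⁻¹ := by
        intro x hx
        rw [hder x hx, hdd x hx]
        have := (hg x hx).1.ne'
        have := (hpos _ (hJm x hx)).ne'
        field_simp
      refine ⟨?_, ?_, ?_⟩
      · intro x hx
        rw [hdd x hx]
        exact (mul_pos (hpos _ (hJm x hx)) (hg x hx).1).ne'
      · intro x hx
        rw [hρ x hx]
        exact inv_pos.2 (hpos _ (hJm x hx))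
      · have hq := hcc.neg
        set q : ℝ → ℝ := -(fun t => g (K t) / G' t) with hqdef
        have hcv : ConcaveOn ℝ I (fun x => (G' (f x))⁻¹) := by
          refine aux_concave hIcv (f' := fun x => - derivWithin q (Ioi (f x)) (f x) - 1)
            (hG'f.inv₀ (fun x hx => (hpos _ (hJm x hx)).ne')) ?_ ?_
          · intro x hx
            have hxn := hIop.mem_nhds hx
            have hint : f x ∈ interior (f '' I) := by
              rw [hJop.interior_eq]; exact hJm x hx
            have h1 := hq.hasDerivWithinAt_rightDeriv_of_mem_interior hint
            set w := derivWithin q (Ioi (f x)) (f x)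
            have h2 : HasDerivWithinAt (q ∘ f) (w * g x) (Ioi x ∩ I) x :=
              HasDerivWithinAt.comp x h1 ((hg x hx).2.hasDerivWithinAt)
                (fun z hz => hfm hx hz.2 hz.1)
            have hgx := (hg x hx).1.ne'
            have hGx := (hpos _ (hJm x hx)).ne'
            have h3 := h2.neg.div ((hg' x hx).hasDerivWithinAt (s := Ioi x ∩ I)) hgx
            have qe : ∀ z ∈ I, q (f z) = -(g z / G' (f z)) := by
              intro z hz
              simp only [hqdef, Pi.neg_apply]
              rw [hKf z hz]
            have h4 : HasDerivWithinAt (fun x => (G' (f x))⁻¹) (-w - 1) (Ioi x ∩ I) x := by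
              refine (h3.congr_deriv ?_).congr ?_ ?_
              · simp only [Pi.neg_apply, Function.comp_apply]
                rw [qe x hx]
                field_simp
              · intro z hz
                have := (hg z hz.2).1.ne'
                have := (hpos _ (hJm z hz.2)).ne'
                simp only [Pi.div_apply, Pi.neg_apply, Function.comp_apply]
                rw [qe z hz.2]
                field_simp
              · simp only [Pi.div_apply, Pi.neg_apply, Function.comp_apply]
                rw [qe x hx]
                field_simp
            exact (hasDerivWithinAt_inter hxn).1 h4
          · intro x hx y hy hxy
            have := hq.monotoneOn_rightDeriv (a := f x) (b := f y)
              (by rw [hJop.interior_eq]; exact hJm x hx) (by rw [hJop.interior_eq]; exact hJm y hy)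
              (hfm.monotoneOn hx hy hxy)
            simp only at this ⊢
            linarith
        exact hcv.congr (fun x hx => (hρ x hx).symm)

theorem stmt_13 (I : Set ℝ) (hIop : IsOpen I) (hIcv : Convex ℝ I) (hIne : I.Nonempty)
    (f : ℝ → ℝ) (hfc : ContinuousOn f I)
    (hfm : StrictMonoOn f I ∨ StrictAntiOn f I)
    (A : ℝ → ℝ → ℝ)
    (hA : ∀ x ∈ I, ∀ y ∈ I, A x y ∈ I ∧ f (A x y) = (f x + f y) / 2)
    (hconv : ∀ x ∈ I, ∀ y ∈ I, ∀ u ∈ I, ∀ v ∈ I,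
      A ((x + y) / 2) ((u + v) / 2) ≤ (A x u + A y v) / 2) :
    ContDiffOn ℝ 2 f I ∧ (∀ x ∈ I, deriv f x ≠ 0) ∧
    ((∀ x ∈ I, deriv (deriv f) x = 0) ∨
      ((∀ x ∈ I, deriv (deriv f) x ≠ 0) ∧
        (∀ x ∈ I, 0 < deriv f x / deriv (deriv f) x) ∧
        ConcaveOn ℝ I (fun x => deriv f x / deriv (deriv f) x))) := by
  rcases hfm with h | h
  · exact aux_main hIop hIcv hfc h hA hconv
  · have := aux_main hIop hIcv (f := fun x => - f x) hfc.neg h.neg (A := A)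
      (fun x hx y hy => ⟨(hA x hx y hy).1, by rw [(hA x hx y hy).2]; ring⟩) hconv
    have e1 : deriv (fun x => - f x) = fun x => - deriv f x := by
      funext x; exact deriv.fun_neg
    have e2 : deriv (fun x => - deriv f x) = fun x => - deriv (deriv f) x := by
      funext x; exact deriv.fun_neg
    simp only [e1, e2, neg_div_neg_eq, neg_eq_zero, ne_eq] at this
    refine ⟨?_, this.2⟩
    simpa using this.1.neg
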